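/- For any two C² functions H1, H2 on R⁴, the vectors U = ∇H1 × ∇H2 and V = (∂ᵤH1)∇H2 - (∂ᵤH2)∇H1 satisfy ∇·U = 0 and ∂ᵤU - ∇×V = 0, hence the associated 4×4 skew matrix satisfies the Jacobi identity. -/

import Mathlib

open Matrix

/-- Partial derivative of F : ℝ⁴ → ℝ in the i-th coordinate direction;
coordinates are (u,x,y,z) = (0,1,2,3). -/
noncomputable def pd (i : Fin 4) (F : (Fin 4 → ℝ) → ℝ) (p : Fin 4 → ℝ) : ℝ :=
  fderiv ℝ F p (Pi.single i 1)

/-- Spatial gradient (in the (x,y,z) = (1,2,3) coordinates) of F : ℝ⁴ → ℝ. -/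
noncomputable def sgrad (F : (Fin 4 → ℝ) → ℝ) (p : Fin 4 → ℝ) : Fin 3 → ℝ :=
  ![pd 1 F p, pd 2 F p, pd 3 F p]

/-- The vector U = ∇H₁ × ∇H₂. -/
noncomputable def Uvec (H₁ H₂ : (Fin 4 → ℝ) → ℝ) (p : Fin 4 → ℝ) : Fin 3 → ℝ :=
  crossProduct (sgrad H₁ p) (sgrad H₂ p)

/-- The vector V = (∂ᵤH₁)∇H₂ - (∂ᵤH₂)∇H₁. -/
noncomputable def Vvec (H₁ H₂ : (Fin 4 → ℝ) → ℝ) (p : Fin 4 → ℝ) : Fin 3 → ℝ :=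
  pd 0 H₁ p • sgrad H₂ p - pd 0 H₂ p • sgrad H₁ p

lemma pd_differentiable {F : (Fin 4 → ℝ) → ℝ} (h : ContDiff ℝ 2 F) (i : Fin 4) :
    Differentiable ℝ (pd i F) := by
  have h' : Differentiable ℝ (fderiv ℝ F) :=
    (h.fderiv_right (m := 1) (by norm_num)).differentiable (by norm_num)
  intro p
  exact (h' p).clm_apply (differentiableAt_const _)

lemma pd_pd {F : (Fin 4 → ℝ) → ℝ} (h : ContDiff ℝ 2 F) (i j : Fin 4) (p : Fin 4 → ℝ) :
    pd i (pd j F) p = fderiv ℝ (fderiv ℝ F) p (Pi.single i 1) (Pi.single j 1) := by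
  have h' : Differentiable ℝ (fderiv ℝ F) :=
    (h.fderiv_right (m := 1) (by norm_num)).differentiable (by norm_num)
  have := (h' p).hasFDerivAt.clm_apply (hasFDerivAt_const (Pi.single j 1 : Fin 4 → ℝ) p)
  have h2 : fderiv ℝ (pd j F) p = _ := this.fderiv
  rw [pd, h2]
  simp

lemma pd_comm {F : (Fin 4 → ℝ) → ℝ} (h : ContDiff ℝ 2 F) (i j : Fin 4) (p : Fin 4 → ℝ) :
    pd i (pd j F) p = pd j (pd i F) p := by
  rw [pd_pd h, pd_pd h]
  exact (h.contDiffAt.isSymmSndFDerivAt (by simp)) _ _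

lemma pd_mul_sub {a b c d : (Fin 4 → ℝ) → ℝ} (ha : Differentiable ℝ a)
    (hb : Differentiable ℝ b) (hc : Differentiable ℝ c) (hd : Differentiable ℝ d)
    (i : Fin 4) (p : Fin 4 → ℝ) :
    pd i (fun q => a q * b q - c q * d q) p =
      a p * pd i b p + b p * pd i a p - (c p * pd i d p + d p * pd i c p) := by
  have := ((ha p).hasFDerivAt.mul (hb p).hasFDerivAt).sub
    ((hc p).hasFDerivAt.mul (hd p).hasFDerivAt)
  have h2 : fderiv ℝ (fun q => a q * b q - c q * d q) p = _ := this.fderiv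
  rw [pd, h2]
  simp [pd]

/-- For C² functions H₁, H₂ on ℝ⁴, the vectors U = ∇H₁ × ∇H₂ and
V = (∂ᵤH₁)∇H₂ - (∂ᵤH₂)∇H₁ satisfy ∇·U = 0 and ∂ᵤU - ∇×V = 0, hence the
associated 4×4 skew-symmetric (degenerate) matrix satisfies the Jacobi
identity. -/
theorem jacobi_identity_for_UV (H₁ H₂ : (Fin 4 → ℝ) → ℝ)
    (h₁ : ContDiff ℝ 2 H₁) (h₂ : ContDiff ℝ 2 H₂) :
    (∀ p : Fin 4 → ℝ,
      pd 1 (fun q => Uvec H₁ H₂ q 0) p +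
      pd 2 (fun q => Uvec H₁ H₂ q 1) p +
      pd 3 (fun q => Uvec H₁ H₂ q 2) p = 0) ∧
    (∀ p : Fin 4 → ℝ,
      pd 0 (fun q => Uvec H₁ H₂ q 0) p =
        pd 2 (fun q => Vvec H₁ H₂ q 2) p - pd 3 (fun q => Vvec H₁ H₂ q 1) p ∧
      pd 0 (fun q => Uvec H₁ H₂ q 1) p =
        pd 3 (fun q => Vvec H₁ H₂ q 0) p - pd 1 (fun q => Vvec H₁ H₂ q 2) p ∧
      pd 0 (fun q => Uvec H₁ H₂ q 2) p =
        pd 1 (fun q => Vvec H₁ H₂ q 1) p - pd 2 (fun q => Vvec H₁ H₂ q 0) p) := by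
  have d₁ := pd_differentiable h₁
  have d₂ := pd_differentiable h₂
  have c₁ := pd_comm h₁
  have c₂ := pd_comm h₂
  have u0 : (fun q => Uvec H₁ H₂ q 0) =
      fun q => pd 2 H₁ q * pd 3 H₂ q - pd 3 H₁ q * pd 2 H₂ q := by
    funext q; simp [Uvec, sgrad, cross_apply]
  have u1 : (fun q => Uvec H₁ H₂ q 1) =
      fun q => pd 3 H₁ q * pd 1 H₂ q - pd 1 H₁ q * pd 3 H₂ q := by
    funext q; simp [Uvec, sgrad, cross_apply]
  have u2 : (fun q => Uvec H₁ H₂ q 2) =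
      fun q => pd 1 H₁ q * pd 2 H₂ q - pd 2 H₁ q * pd 1 H₂ q := by
    funext q; simp [Uvec, sgrad, cross_apply]
  have v0 : (fun q => Vvec H₁ H₂ q 0) =
      fun q => pd 0 H₁ q * pd 1 H₂ q - pd 0 H₂ q * pd 1 H₁ q := by
    funext q; simp [Vvec, sgrad]
  have v1 : (fun q => Vvec H₁ H₂ q 1) =
      fun q => pd 0 H₁ q * pd 2 H₂ q - pd 0 H₂ q * pd 2 H₁ q := by
    funext q; simp [Vvec, sgrad]
  have v2 : (fun q => Vvec H₁ H₂ q 2) =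
      fun q => pd 0 H₁ q * pd 3 H₂ q - pd 0 H₂ q * pd 3 H₁ q := by
    funext q; simp [Vvec, sgrad]
  rw [u0, u1, u2, v0, v1, v2]
  simp only [pd_mul_sub (d₁ _) (d₂ _) (d₁ _) (d₂ _), pd_mul_sub (d₁ _) (d₂ _) (d₂ _) (d₁ _)]
  refine ⟨fun p => ?_, fun p => ⟨?_, ?_, ?_⟩⟩ <;>
  · simp only [c₁ 1 0, c₁ 2 0, c₁ 3 0, c₁ 2 1, c₁ 3 1, c₁ 3 2,
      c₂ 1 0, c₂ 2 0, c₂ 3 0, c₂ 2 1, c₂ 3 1, c₂ 3 2]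
    ring
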